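/- The series Σ_{j=25}^∞ (1 + 3/(2(j+1)))·a_j²·ω_{j+1} converges and its sum is strictly greater than 3·a₂₅²·ω₂₆. (The tail lower bound in the proof of inequality (4.4) of Proposition 3.3.) -/

import Mathlib

open Finset

/-- The weights `ω_k = (2k choose k)/4^k`. -/
noncomputable def ω : ℕ → ℝ :=
  fun k => (Nat.choose (2 * k) k : ℝ) / 4 ^ k

/-- Maclaurin coefficients of `F(z) = (1 - √(2/3) z)^(-5/2)`. -/
noncomputable def a : ℕ → ℝ :=
  fun j => ∏ t ∈ Finset.Icc 1 j, (Real.sqrt (2 / 3) * (1 + 3 / (2 * (t : ℝ))))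

noncomputable def S₁ : ℝ :=
  Real.sqrt (2 / 3) * ∑ j ∈ Finset.range 25, (1 + 3 / (2 * ((j : ℝ) + 1))) * (a j) ^ 2 * ω (j + 1)

noncomputable def S₂ : ℝ :=
  ∑ j ∈ Finset.range 25, (a j) ^ 2 * ω (j + 1)

noncomputable def S₃ : ℝ :=
  (5 - Real.sqrt 6) * (a 25) ^ 2 * ω 26

noncomputable def S₄ : ℝ :=
  ∑ j ∈ Finset.range 25, (a j) ^ 2 * ω (j + 1) / ((j : ℝ) + 1)

theorem omega_pos (k : ℕ) : 0 < ω k := by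
  unfold ω
  have : 0 < Nat.choose (2 * k) k := Nat.choose_pos (by omega)
  positivity

theorem omega_succ (k : ℕ) : ω (k + 1) = ω k * ((2 * k + 1) / (2 * k + 2)) := by
  unfold ω
  have h := Nat.succ_mul_centralBinom_succ k
  simp only [Nat.centralBinom] at h
  have h2 : ((k : ℝ) + 1) * (Nat.choose (2 * (k + 1)) (k + 1) : ℝ)
      = 2 * (2 * k + 1) * (Nat.choose (2 * k) k : ℝ) := by exact_mod_cast h
  have hk : (k : ℝ) + 1 ≠ 0 := by positivity
  have h3 : (Nat.choose (2 * (k + 1)) (k + 1) : ℝ)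
      = 2 * (2 * k + 1) * (Nat.choose (2 * k) k : ℝ) / (k + 1) := by
    rw [eq_div_iff hk]; linarith
  rw [h3]
  have hk2 : 2 * (k : ℝ) + 2 ≠ 0 := by positivity
  field_simp
  ring

theorem a_pos (j : ℕ) : 0 < a j := by
  unfold a
  apply Finset.prod_pos
  intro t _
  positivity

theorem a_sq_succ (j : ℕ) :
    (a (j + 1)) ^ 2 = (a j) ^ 2 * (2 / 3 * (1 + 3 / (2 * ((j : ℝ) + 1))) ^ 2) := by
  unfold a
  rw [Finset.prod_Icc_succ_top (by omega), mul_pow, mul_pow, Real.sq_sqrt (by norm_num)]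
  push_cast
  rfl

theorem u_bounds (j : ℕ) :
    (2 / 3 : ℝ) ^ j * ((a 25) ^ 2 * ω 26) ≤ (a (j + 25)) ^ 2 * ω (j + 25 + 1) ∧
    (a (j + 25)) ^ 2 * ω (j + 25 + 1) ≤ (3 / 4 : ℝ) ^ j * ((a 25) ^ 2 * ω 26) := by
  induction j with
  | zero => simp
  | succ j ih =>
    have e : j + 1 + 25 = j + 25 + 1 := by omega
    rw [e, a_sq_succ (j + 25), omega_succ (j + 25 + 1)]
    have hu : 0 < (a (j + 25)) ^ 2 * ω (j + 25 + 1) :=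
      mul_pos (pow_pos (a_pos _) 2) (omega_pos _)
    set A := (a (j + 25)) ^ 2
    set W := ω (j + 25 + 1)
    push_cast
    have hj : (0 : ℝ) ≤ j := Nat.cast_nonneg j
    set x : ℝ := (j : ℝ) + 25 + 1 with hx
    have hx26 : 26 ≤ x := by rw [hx]; linarith
    have hx0 : 0 < x := by linarith
    have key : A * (2 / 3 * (1 + 3 / (2 * x)) ^ 2) * (W * ((2 * x + 1) / (2 * x + 2)))
        = (2 / 3 * (1 + 3 / (2 * x)) ^ 2 * ((2 * x + 1) / (2 * x + 2))) * (A * W) := by ring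
    rw [key, pow_succ (2 / 3 : ℝ) j, pow_succ (3 / 4 : ℝ) j]
    have r1 : 2 / 3 ≤ 2 / 3 * (1 + 3 / (2 * x)) ^ 2 * ((2 * x + 1) / (2 * x + 2)) := by
      have : 2 / 3 * (1 + 3 / (2 * x)) ^ 2 * ((2 * x + 1) / (2 * x + 2))
          = 2 / 3 * ((2 * x + 3) ^ 2 * (2 * x + 1) / (4 * x ^ 2 * (2 * x + 2))) := by
        field_simp
        try ring
      rw [this]
      have : 1 ≤ (2 * x + 3) ^ 2 * (2 * x + 1) / (4 * x ^ 2 * (2 * x + 2)) := by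
        rw [le_div_iff₀ (by positivity)]
        nlinarith [sq_nonneg x]
      linarith
    have r2 : 2 / 3 * (1 + 3 / (2 * x)) ^ 2 * ((2 * x + 1) / (2 * x + 2)) ≤ 3 / 4 := by
      have b1 : 3 / (2 * x) ≤ 3 / 52 := by
        apply div_le_div_of_nonneg_left <;> linarith
      have b0 : 0 ≤ 3 / (2 * x) := by positivity
      have b2 : (2 * x + 1) / (2 * x + 2) ≤ 1 := by
        rw [div_le_one (by linarith)]; linarith
      have b3 : 2 / 3 * (1 + 3 / (2 * x)) ^ 2 ≤ 3 / 4 := by nlinarith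
      calc _ ≤ 2 / 3 * (1 + 3 / (2 * x)) ^ 2 * 1 :=
            mul_le_mul_of_nonneg_left b2 (by positivity)
        _ ≤ 3 / 4 := by linarith
    constructor
    · calc _ = 2 / 3 * ((2 / 3 : ℝ) ^ j * ((a 25) ^ 2 * ω 26)) := by ring
        _ ≤ 2 / 3 * (A * W) := by linarith [ih.1]
        _ ≤ _ := mul_le_mul_of_nonneg_right r1 hu.le
    · calc _ ≤ 3 / 4 * (A * W) := mul_le_mul_of_nonneg_right r2 hu.le
        _ ≤ 3 / 4 * ((3 / 4 : ℝ) ^ j * ((a 25) ^ 2 * ω 26)) := by linarith [ih.2]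
        _ = _ := by ring

/-- Tail lower bound in the proof of (4.4):
`Σ_{j=25}^∞ (1 + 3/(2(j+1))) a_j² ω_{j+1} > 3 a₂₅² ω₂₆`. -/
theorem tail_lower_bound :
    Summable (fun j : ℕ =>
      (1 + 3 / (2 * (((j + 25 : ℕ) : ℝ) + 1))) * (a (j + 25)) ^ 2 * ω (j + 25 + 1)) ∧
    (∑' j : ℕ, (1 + 3 / (2 * (((j + 25 : ℕ) : ℝ) + 1))) * (a (j + 25)) ^ 2 * ω (j + 25 + 1))
      > 3 * (a 25) ^ 2 * ω 26 := by
  have hpos : ∀ j : ℕ, 0 < (a (j + 25)) ^ 2 * ω (j + 25 + 1) := fun j =>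
    mul_pos (pow_pos (a_pos _) 2) (omega_pos _)
  have lo : ∀ j : ℕ, (2 / 3 : ℝ) ^ j * ((a 25) ^ 2 * ω 26) <
      (1 + 3 / (2 * (((j + 25 : ℕ) : ℝ) + 1))) * (a (j + 25)) ^ 2 * ω (j + 25 + 1) := by
    intro j
    have h : (0 : ℝ) < 3 / (2 * (((j + 25 : ℕ) : ℝ) + 1)) := by positivity
    have := mul_pos h (hpos j)
    have := (u_bounds j).1
    rw [mul_assoc]
    linarith
  have hi : ∀ j : ℕ,
      (1 + 3 / (2 * (((j + 25 : ℕ) : ℝ) + 1))) * (a (j + 25)) ^ 2 * ω (j + 25 + 1) ≤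
      (3 / 4 : ℝ) ^ j * (2 * ((a 25) ^ 2 * ω 26)) := by
    intro j
    have h : 3 / (2 * (((j + 25 : ℕ) : ℝ) + 1)) ≤ 1 := by
      rw [div_le_one (by positivity)]
      push_cast
      linarith [Nat.cast_nonneg (α := ℝ) j]
    have := mul_le_mul_of_nonneg_right h (hpos j).le
    have := (u_bounds j).2
    rw [mul_assoc]
    linarith
  have h25 : 0 < (a 25) ^ 2 * ω 26 := hpos 0
  have hs : Summable (fun j : ℕ =>
      (1 + 3 / (2 * (((j + 25 : ℕ) : ℝ) + 1))) * (a (j + 25)) ^ 2 * ω (j + 25 + 1)) := by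
    refine Summable.of_nonneg_of_le (fun j => ?_) hi
      ((summable_geometric_of_lt_one (by norm_num) (by norm_num)).mul_right _)
    exact le_trans (by positivity) (lo j).le
  refine ⟨hs, ?_⟩
  have hg : HasSum (fun j : ℕ => (2 / 3 : ℝ) ^ j * ((a 25) ^ 2 * ω 26))
      ((1 - 2 / 3)⁻¹ * ((a 25) ^ 2 * ω 26)) :=
    (hasSum_geometric_of_lt_one (by norm_num) (by norm_num)).mul_right _
  have := hg.summable.tsum_lt_tsum (fun j => (lo j).le) (lo 0) hs
  rw [hg.tsum_eq] at this
  calc 3 * (a 25) ^ 2 * ω 26 = (1 - 2 / 3)⁻¹ * ((a 25) ^ 2 * ω 26) := by norm_num; ring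
    _ < _ := this
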